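/- arXiv:1010.3821 — 2 statements merged into one kernel-verified Lean document; each statement's English description precedes it below -/
import Mathlib

section
/- For all s > r > 1, δ(r,s) = (r-1)/((r+1)^(s(r-1)/(r(s-1))) - 1) - 1 + 1/s satisfies δ(r,s) ≤ 1/log 2 - 1. -/
open Real

/-- The derivative of `x * log (2 + x) - (1 + x) * log (1 + l * x)` is nonnegative on `[0, ∞)` when
`l = log 2`. -/
lemma log_two_add_sub_nonneg {x : ℝ} (hx : 0 ≤ x) :
    0 ≤ log (2 + x) + x / (2 + x) - log (1 + log 2 * x)
      - log 2 * (1 + x) / (1 + log 2 * x) := by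
  have hl : 0 < log 2 := log_pos one_lt_two
  set l := log 2 with hl_def
  have hd : ∀ y ∈ Set.Ici (0 : ℝ), HasDerivAt
      (fun y => log (2 + y) + y / (2 + y) - log (1 + l * y) - l * (1 + y) / (1 + l * y))
      (((1 - l) ^ 2 * 4 + y + l ^ 2 * y ^ 2) / ((2 + y) ^ 2 * (1 + l * y) ^ 2)) y := by
    intro y hy
    have hy : 0 ≤ y := hy
    have h2 : 2 + y ≠ 0 := by positivity
    have h1 : 1 + l * y ≠ 0 := by positivity
    have d2 : HasDerivAt (fun y : ℝ => 2 + y) 1 y := (hasDerivAt_id y).const_add 2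
    have d3 : HasDerivAt (fun y : ℝ => l * (1 + y)) (l * 1) y :=
      ((hasDerivAt_id y).const_add 1).const_mul l
    have d1 : HasDerivAt (fun y : ℝ => 1 + l * y) (l * 1) y :=
      ((hasDerivAt_id y).const_mul l).const_add 1
    refine ((((d2.log h2).add ((hasDerivAt_id y).div d2 h2)).sub (d1.log h1)).sub
      (d3.div d1 h1)).congr_deriv ?_
    simp only [id]
    field_simp
    ring
  have hmono : MonotoneOn
      (fun y => log (2 + y) + y / (2 + y) - log (1 + l * y) - l * (1 + y) / (1 + l * y))
      (Set.Ici 0) := by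
    refine monotoneOn_of_hasDerivWithinAt_nonneg (convex_Ici 0)
      (fun y hy => (hd y hy).continuousAt.continuousWithinAt)
      (fun y hy => (hd y (interior_subset hy)).hasDerivWithinAt) fun y hy => ?_
    have hy : 0 ≤ y := interior_subset hy
    positivity
  simpa [← hl_def] using hmono Set.self_mem_Ici hx hx

lemma one_add_mul_log_le {x : ℝ} (hx : 0 ≤ x) :
    (1 + x) * log (1 + log 2 * x) ≤ x * log (2 + x) := by
  have hl : 0 < log 2 := log_pos one_lt_two
  have hd : ∀ y ∈ Set.Ici (0 : ℝ), HasDerivAt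
      (fun y => y * log (2 + y) - (1 + y) * log (1 + log 2 * y))
      (log (2 + y) + y / (2 + y) - log (1 + log 2 * y)
        - log 2 * (1 + y) / (1 + log 2 * y)) y := by
    intro y hy
    have hy : 0 ≤ y := hy
    have h2 : 2 + y ≠ 0 := by positivity
    have h1 : 1 + log 2 * y ≠ 0 := by positivity
    have d2 : HasDerivAt (fun y : ℝ => 2 + y) 1 y := (hasDerivAt_id y).const_add 2
    have d3 : HasDerivAt (fun y : ℝ => 1 + y) 1 y := (hasDerivAt_id y).const_add 1
    have d1 : HasDerivAt (fun y : ℝ => 1 + log 2 * y) (log 2 * 1) y :=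
      ((hasDerivAt_id y).const_mul (log 2)).const_add 1
    refine (((hasDerivAt_id y).mul (d2.log h2)).sub (d3.mul (d1.log h1))).congr_deriv ?_
    simp only [id]
    ring
  have hmono : MonotoneOn (fun y => y * log (2 + y) - (1 + y) * log (1 + log 2 * y))
      (Set.Ici 0) :=
    monotoneOn_of_hasDerivWithinAt_nonneg (convex_Ici 0)
      (fun y hy => (hd y hy).continuousAt.continuousWithinAt)
      (fun y hy => (hd y (interior_subset hy)).hasDerivWithinAt)
      fun y hy => log_two_add_sub_nonneg (interior_subset hy)
  simpa using hmono Set.self_mem_Ici hx hx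

/-- Concavity of `log` in the form `t log (1 + y) ≤ log (1 + t y)`, applied at `y = a / (t + b)`. -/
lemma mul_log_one_add_div_le {a b t : ℝ} (ha : 0 ≤ a) (hb : 0 ≤ b) (ht : 0 < t) (ht1 : t ≤ 1) :
    t * log (1 + a / (t + b)) ≤ log (1 + a / (1 + b)) := by
  have hy : 0 ≤ a / (t + b) := by positivity
  rw [← log_rpow (by positivity)]
  refine log_le_log (by positivity) ((rpow_one_add_le_one_add_mul_self (by linarith)
    ht.le ht1).trans ?_)
  have : t * (a / (t + b)) ≤ a / (1 + b) := by
    rw [mul_div_assoc', div_le_div_iff₀ (by positivity) (by positivity)]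
    nlinarith [mul_nonneg ha (mul_nonneg hb (sub_nonneg.2 ht1))]
  linarith

/-- For all `s > r > 1`, the two-rate threshold
`δ(r,s) = (r-1)/((r+1)^(s(r-1)/(r(s-1))) - 1) - 1 + 1/s` is bounded by `1/log 2 - 1`. -/
theorem delta_two_rate_le (r s : ℝ) (hr : 1 < r) (hs : r < s) :
    (r - 1) / ((r + 1) ^ (s * (r - 1) / (r * (s - 1))) - 1) - 1 + 1 / s
      ≤ 1 / Real.log 2 - 1 := by
  have hl : 0 < log 2 := log_pos one_lt_two
  have hb : 0 < 1 / log 2 - 1 := by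
    rw [sub_pos, lt_div_iff₀ hl]
    linarith [log_two_lt_d9]
  have hs0 : 0 < s := by linarith
  have hs1 : 0 < s - 1 := by linarith
  have ha : 0 < r - 1 := by linarith
  have ht : 0 < (s - 1) / s := by positivity
  have ht1 : (s - 1) / s ≤ 1 := by rw [div_le_one hs0]; linarith
  have hts : (s - 1) / s = 1 - 1 / s := by field_simp
  have hdiv : (r - 1) / (1 + (1 / log 2 - 1)) = log 2 * (r - 1) := by field_simp; ring
  have hconc := mul_log_one_add_div_le ha.le hb.le ht ht1
  rw [hdiv] at hconc
  have hlog := one_add_mul_log_le ha.le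
  rw [show 1 + (r - 1) = r by ring, show 2 + (r - 1) = r + 1 by ring] at hlog
  set d := (s - 1) / s + (1 / log 2 - 1) with hd_def
  have hd : 0 < d := by positivity
  have hpow : 1 + (r - 1) / d ≤ (r + 1) ^ (s * (r - 1) / (r * (s - 1))) := by
    rw [← log_le_log_iff (by positivity) (by positivity), log_rpow (by positivity),
      div_mul_eq_mul_div, le_div_iff₀ (by positivity)]
    rw [div_mul_eq_mul_div, div_le_iff₀ hs0] at hconc
    nlinarith [mul_le_mul_of_nonneg_left hconc (by linarith : 0 ≤ r),
      mul_le_mul_of_nonneg_left hlog hs0.le]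
  have hpos : 0 < (r - 1) / d := by positivity
  have hmain : (r - 1) / ((r + 1) ^ (s * (r - 1) / (r * (s - 1))) - 1) ≤ d := by
    rw [div_le_iff₀ (by linarith), mul_comm, ← div_le_iff₀ hd]
    linarith
  linarith
end

section
/- Define R(t,r) = ((2r+t)/(2r²))·log((2r+t)/t) − 1/r for t ≥ 1 and r ≥ 1, and δ(r) = (r-1)/((r+1)^((r-1)/r) - 1) - 1. Then for all r > 1, R(2,r) < δ(r) < R(1,r). -/
open Real

/-- A function vanishing at `0` with positive derivative on `(0, ∞)` is positive there. -/
lemma pos_of_hasDerivAt_pos {g g' : ℝ → ℝ} (h0 : g 0 = 0)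
    (hd : ∀ x, 0 ≤ x → HasDerivAt g (g' x) x) (hpos : ∀ x, 0 < x → 0 < g' x)
    {x : ℝ} (hx : 0 < x) : 0 < g x := by
  have hmono : StrictMonoOn g (Set.Ici 0) := by
    refine strictMonoOn_of_deriv_pos (convex_Ici 0)
      (fun y hy => (hd y hy).continuousAt.continuousWithinAt) fun y hy => ?_
    rw [interior_Ici] at hy
    rw [(hd y (le_of_lt hy)).deriv]
    exact hpos y hy
  have h := hmono (Set.mem_Ici.2 le_rfl) (Set.mem_Ici.2 hx.le) hx
  rwa [h0] at h

lemma hasDerivAt_log_one_add {x : ℝ} (hx : 0 ≤ x) :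
    HasDerivAt (fun y : ℝ => log (1 + y)) (1 / (1 + x)) x :=
  ((hasDerivAt_id' x).const_add 1).log (by positivity)

lemma log_one_add_lt_mul_div {x : ℝ} (hx : 0 < x) :
    log (1 + x) < x * (2 + x) / (2 * (1 + x)) := by
  refine sub_pos.1 (pos_of_hasDerivAt_pos
    (g := fun y => y * (2 + y) / (2 * (1 + y)) - log (1 + y))
    (g' := fun y => y ^ 2 / (2 * (1 + y) ^ 2)) (by simp) (fun y hy => ?_)
    (fun y hy => by positivity) hx)
  have h2 : (2 * (1 + y)) ≠ 0 := by positivity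
  have h1 : 1 + y ≠ 0 := by positivity
  refine HasDerivAt.congr_deriv ((((hasDerivAt_id' y).mul ((hasDerivAt_id' y).const_add 2)).div
    (((hasDerivAt_id' y).const_add 1).const_mul 2) h2).sub (hasDerivAt_log_one_add hy)) ?_
  simp only [Pi.mul_apply]
  field_simp
  ring

lemma pade_lt_log_one_add {x : ℝ} (hx : 0 < x) :
    3 * x * (2 + x) / (6 + 6 * x + x ^ 2) < log (1 + x) := by
  refine sub_pos.1 (pos_of_hasDerivAt_pos
    (g := fun y => log (1 + y) - 3 * y * (2 + y) / (6 + 6 * y + y ^ 2))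
    (g' := fun y => y ^ 4 / ((1 + y) * (6 + 6 * y + y ^ 2) ^ 2)) (by simp) (fun y hy => ?_)
    (fun y hy => by positivity) hx)
  have h2 : 6 + 6 * y + y ^ 2 ≠ 0 := by positivity
  have h1 : 1 + y ≠ 0 := by positivity
  refine HasDerivAt.congr_deriv ((hasDerivAt_log_one_add hy).sub
    ((((hasDerivAt_id' y).const_mul 3).mul ((hasDerivAt_id' y).const_add 2)).div
    ((((hasDerivAt_id' y).const_mul 6).const_add 6).add ((hasDerivAt_id' y).pow 2)) h2)) ?_
  simp only [Pi.mul_apply]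
  push_cast
  field_simp
  ring

lemma log_one_add_lt_rational {x : ℝ} (hx : 0 < x) :
    log (1 + x) < x * (3 * x ^ 2 + 11 * x + 6) / (2 * ((1 + x) * (3 + 4 * x))) := by
  refine sub_pos.1 (pos_of_hasDerivAt_pos
    (g := fun y => y * (3 * y ^ 2 + 11 * y + 6) / (2 * ((1 + y) * (3 + 4 * y))) - log (1 + y))
    (g' := fun y => (y ^ 3 * (10 + 12 * y)) / (2 * (1 + y) ^ 2 * (3 + 4 * y) ^ 2))
    (by simp) (fun y hy => ?_)
    (fun y hy => by positivity) hx)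
  have h2 : 2 * ((1 + y) * (3 + 4 * y)) ≠ 0 := by positivity
  have h1 : 1 + y ≠ 0 := by positivity
  have h3 : 3 + 4 * y ≠ 0 := by positivity
  refine HasDerivAt.congr_deriv ((((hasDerivAt_id' y).mul (((((hasDerivAt_id' y).pow 2).const_mul 3).add
    ((hasDerivAt_id' y).const_mul 11)).add_const 6)).div
    ((((hasDerivAt_id' y).const_add 1).mul
      (((hasDerivAt_id' y).const_mul 4).const_add 3)).const_mul 2) h2).sub
    (hasDerivAt_log_one_add hy)) ?_
  simp only [Pi.add_apply, Pi.pow_apply, Pi.mul_apply]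
  push_cast
  field_simp
  ring

lemma four_mul_sq_log_one_add_lt {x : ℝ} (hx : 0 < x) :
    4 * log (1 + x) ^ 2 <
      x ^ 3 / (1 + x) ^ 2 + 2 * x ^ 2 / (1 + x) + 2 * x / (1 + x) * log (1 + x) := by
  refine sub_pos.1 (pos_of_hasDerivAt_pos
    (g := fun y => y ^ 3 / (1 + y) ^ 2 + 2 * y ^ 2 / (1 + y) + 2 * y / (1 + y) * log (1 + y)
      - 4 * log (1 + y) ^ 2)
    (g' := fun y => (2 * (3 + 4 * y) / (1 + y) ^ 2) *
      (y * (3 * y ^ 2 + 11 * y + 6) / (2 * ((1 + y) * (3 + 4 * y))) - log (1 + y)))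
    (by simp) (fun y hy => ?_)
    (fun y hy => mul_pos (by positivity) (sub_pos.2 (log_one_add_lt_rational hy))) hx)
  have h2 : (1 + y) ^ 2 ≠ 0 := by positivity
  have h1 : 1 + y ≠ 0 := by positivity
  have h3 : 3 + 4 * y ≠ 0 := by positivity
  have hl := hasDerivAt_log_one_add hy
  have hid := hasDerivAt_id' y
  refine HasDerivAt.congr_deriv (((((hid.pow 3).div ((hid.const_add 1).pow 2) h2).add
    (((hid.pow 2).const_mul 2).div (hid.const_add 1) h1)).add
    (((hid.const_mul 2).div (hid.const_add 1) h1).mul hl)).sub ((hl.pow 2).const_mul 4)) ?_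
  simp only [Pi.pow_apply, Pi.div_apply]
  push_cast
  field_simp
  ring

lemma two_mul_sq_lt_sq_mul_sub_log {x : ℝ} (hx : 0 < x) :
    2 * ((1 + x) * log (1 + x) - x) ^ 2 < x ^ 2 * (x - log (1 + x)) := by
  refine sub_pos.1 (pos_of_hasDerivAt_pos
    (g := fun y => y ^ 2 * (y - log (1 + y)) - 2 * ((1 + y) * log (1 + y) - y) ^ 2)
    (g' := fun y => (1 + y) * (y ^ 3 / (1 + y) ^ 2 + 2 * y ^ 2 / (1 + y)
      + 2 * y / (1 + y) * log (1 + y) - 4 * log (1 + y) ^ 2))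
    (by simp) (fun y hy => ?_)
    (fun y hy => mul_pos (by positivity) (sub_pos.2 (four_mul_sq_log_one_add_lt hy))) hx)
  have h1 : 1 + y ≠ 0 := by positivity
  have hl := hasDerivAt_log_one_add hy
  have hid := hasDerivAt_id' y
  refine HasDerivAt.congr_deriv (((hid.pow 2).mul (hid.sub hl)).sub
    (((((hid.const_add 1).mul hl).sub hid).pow 2).const_mul 2)) ?_
  simp only [Pi.sub_apply, Pi.pow_apply, Pi.mul_apply]
  push_cast
  field_simp
  ring

/-- The mean of `log (1 + u)` for `u` uniform on `[0, x]`. -/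
noncomputable def meanLog (x : ℝ) : ℝ := ((1 + x) * log (1 + x) - x) / x

lemma lt_meanLog {x : ℝ} (hx : 0 < x) :
    x * (3 + 2 * x) / (6 + 6 * x + x ^ 2) < meanLog x := by
  have h := mul_lt_mul_of_pos_left (pade_lt_log_one_add hx) (by positivity : 0 < 1 + x)
  rw [meanLog, lt_div_iff₀ hx]
  refine lt_of_eq_of_lt ?_ (sub_lt_sub_right h x)
  field_simp
  ring

lemma meanLog_pos {x : ℝ} (hx : 0 < x) : 0 < meanLog x :=
  lt_trans (by positivity) (lt_meanLog hx)

lemma meanLog_lt_half {x : ℝ} (hx : 0 < x) : meanLog x < x / 2 := by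
  have h := mul_lt_mul_of_pos_left (log_one_add_lt_mul_div hx) (by positivity : 0 < 1 + x)
  rw [meanLog, div_lt_iff₀ hx]
  refine lt_of_lt_of_eq (sub_lt_sub_right h x) ?_
  field_simp
  ring

lemma strictAntiOn_inv_meanLog_sub :
    StrictAntiOn (fun x => (meanLog x)⁻¹ - 2 / x) (Set.Ioi 0) := by
  have hd : ∀ x : ℝ, 0 < x → HasDerivAt (fun x => (meanLog x)⁻¹ - 2 / x)
      (-((x ^ 2 * (x - log (1 + x)) - 2 * ((1 + x) * log (1 + x) - x) ^ 2)
        / (x ^ 4 * meanLog x ^ 2))) x := by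
    intro x hx
    have hl := hasDerivAt_log_one_add hx.le
    have hid := hasDerivAt_id' x
    have hm : meanLog x ≠ 0 := (meanLog_pos hx).ne'
    have hP : HasDerivAt meanLog ((x - log (1 + x)) / x ^ 2) x := by
      refine HasDerivAt.congr_deriv ((((hid.const_add 1).mul hl).sub hid).div hid hx.ne') ?_
      simp only [Pi.sub_apply, Pi.mul_apply]
      field_simp
      ring
    have hmx : (1 + x) * log (1 + x) - x = x * meanLog x := by
      rw [meanLog]; field_simp
    refine HasDerivAt.congr_deriv ((hP.inv hm).sub ((hasDerivAt_const x (2 : ℝ)).div hid hx.ne')) ?_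
    rw [hmx]
    field_simp
    ring
  refine strictAntiOn_of_deriv_neg (convex_Ioi 0)
    (fun y hy => (hd y hy).continuousAt.continuousWithinAt) fun y hy => ?_
  rw [interior_Ioi] at hy
  have hy' : 0 < y := hy
  rw [(hd y hy).deriv, neg_lt_zero]
  have := meanLog_pos hy'
  exact div_pos (sub_pos.2 (two_mul_sq_lt_sq_mul_sub_log hy')) (by positivity)

lemma sq_lt_sub_meanLog_mul_add_meanLog {r : ℝ} (hr : 0 < r) :
    r ^ 2 < (r - meanLog r) * (r + meanLog (2 * r)) := by
  have h := strictAntiOn_inv_meanLog_sub (Set.mem_Ioi.2 hr)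
    (Set.mem_Ioi.2 (by positivity : 0 < 2 * r)) (by linarith)
  have hP := meanLog_pos hr
  have hQ := meanLog_pos (by positivity : 0 < 2 * r)
  have h1 := mul_pos (sub_pos.2 h) (by positivity : 0 < r * meanLog r * meanLog (2 * r))
  have h2 : ((meanLog r)⁻¹ - 2 / r - ((meanLog (2 * r))⁻¹ - 2 / (2 * r))) *
      (r * meanLog r * meanLog (2 * r)) =
      r * meanLog (2 * r) - r * meanLog r - meanLog r * meanLog (2 * r) := by
    field_simp
    ring
  nlinarith

lemma exp_neg_lt_quadratic {s : ℝ} (hs : 0 < s) : exp (-s) < 1 - s + s ^ 2 / 2 := by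
  have h := quadratic_le_exp_of_nonneg hs.le
  rw [exp_neg, inv_lt_iff_one_lt_mul₀ (exp_pos s)]
  have h4 : 0 < s ^ 4 := by positivity
  have h5 : 0 < 1 - s + s ^ 2 / 2 := by nlinarith [sq_nonneg (s - 1)]
  nlinarith [mul_le_mul_of_nonneg_left h h5.le]

lemma hasDerivAt_exp_sub_div (r : ℝ) (v : ℝ) :
    HasDerivAt (fun y => exp (y - y / r)) (exp (v - v / r) * (1 - 1 / r)) v :=
  ((hasDerivAt_id' v).sub ((hasDerivAt_id' v).div_const r)).exp

lemma exp_sub_div_lower {r v : ℝ} (hr : 1 < r) (hv : 0 < v) :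
    exp v * (1 - (v - 1) / r) - 1 - 1 / r < r / (r - 1) * (exp (v - v / r) - 1) := by
  refine sub_pos.1 (pos_of_hasDerivAt_pos
    (g := fun y => r / (r - 1) * (exp (y - y / r) - 1) -
      (exp y * (1 - (y - 1) / r) - 1 - 1 / r))
    (g' := fun y => exp y * (exp (-(y / r)) - (1 - y / r))) (by simp; ring) (fun y hy => ?_)
    (fun y hy => mul_pos (exp_pos y) (sub_pos.2 ?_)) hv)
  · have hr0 : r ≠ 0 := by positivity
    have hr1 : r - 1 ≠ 0 := (sub_pos.2 hr).ne'
    have hid := hasDerivAt_id' y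
    refine HasDerivAt.congr_deriv ((((hasDerivAt_exp_sub_div r y).sub_const 1).const_mul (r / (r - 1))).sub
      ((((hasDerivAt_exp y).mul (((hid.sub_const 1).div_const r).const_sub 1)).sub_const
        1).sub_const (1 / r))) ?_
    rw [sub_eq_add_neg y (y / r), exp_add]
    field_simp
    ring
  · have : -(y / r) ≠ 0 := (neg_lt_zero.2 (by positivity)).ne
    linarith [add_one_lt_exp this]

lemma exp_sub_div_upper {r v : ℝ} (hr : 1 < r) (hv : 0 < v) :
    r / (r - 1) * (exp (v - v / r) - 1) <
      exp v * (1 - (v - 1) / r + (v ^ 2 - 2 * v + 2) / (2 * r ^ 2)) - 1 - 1 / r - 1 / r ^ 2 := by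
  refine sub_pos.1 (pos_of_hasDerivAt_pos
    (g := fun y =>
      (exp y * (1 - (y - 1) / r + (y ^ 2 - 2 * y + 2) / (2 * r ^ 2)) - 1 - 1 / r - 1 / r ^ 2) -
      r / (r - 1) * (exp (y - y / r) - 1))
    (g' := fun y => exp y * ((1 - y / r + (y / r) ^ 2 / 2) - exp (-(y / r))))
    (by simp; field_simp; ring) (fun y hy => ?_)
    (fun y hy => mul_pos (exp_pos y) (sub_pos.2 (exp_neg_lt_quadratic (by positivity)))) hv)
  have hr0 : r ≠ 0 := by positivity
  have hr1 : r - 1 ≠ 0 := (sub_pos.2 hr).ne'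
  have hid := hasDerivAt_id' y
  refine HasDerivAt.congr_deriv (((((hasDerivAt_exp y).mul ((((hid.sub_const 1).div_const r).const_sub 1).add
      ((((hid.pow 2).sub (hid.const_mul 2)).add_const 2).div_const (2 * r ^ 2)))).sub_const
        1).sub_const (1 / r)).sub_const (1 / r ^ 2) |>.sub
      (((hasDerivAt_exp_sub_div r y).sub_const 1).const_mul (r / (r - 1)))) ?_
  rw [sub_eq_add_neg y (y / r), exp_add]
  simp only [Pi.sub_apply, Pi.add_apply, Pi.pow_apply]
  push_cast
  field_simp
  ring

lemma meanLog_cubic_neg {r : ℝ} (hr0 : 0 < r) :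
    r * meanLog r ^ 3 - r ^ 2 * meanLog r ^ 2 - 2 * r * meanLog r ^ 2 - 2 * meanLog r ^ 2
      - r * meanLog r + r ^ 2 < 0 := by
  have h1 := lt_meanLog hr0
  have h2 := meanLog_lt_half hr0
  set P := meanLog r
  set p := r * (3 + 2 * r) / (6 + 6 * r + r ^ 2) with hp
  have hp0 : 0 < p := by positivity
  have hdec : r * P ^ 3 - r ^ 2 * P ^ 2 - 2 * r * P ^ 2 - 2 * P ^ 2 - r * P + r ^ 2 ≤
      r * p ^ 3 - r ^ 2 * p ^ 2 - 2 * r * p ^ 2 - 2 * p ^ 2 - r * p + r ^ 2 := by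
    have hfac : 0 ≤ r * (r * (P + p) - (P ^ 2 + P * p + p ^ 2))
        + (2 * r + 2) * (P + p) + r := by
      have : 0 ≤ r * (P + p) - (P ^ 2 + P * p + p ^ 2) := by nlinarith
      have : 0 < P := by linarith
      positivity
    nlinarith [mul_nonneg (sub_pos.2 h1).le hfac]
  refine lt_of_le_of_lt hdec ?_
  have hD : 0 < 6 + 6 * r + r ^ 2 := by positivity
  have hval : r * p ^ 3 - r ^ 2 * p ^ 2 - 2 * r * p ^ 2 - 2 * p ^ 2 - r * p + r ^ 2 =
      -(r ^ 4 * (21 + 54 * r + 50 * r ^ 2 + 20 * r ^ 3 + 3 * r ^ 4)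
        / (6 + 6 * r + r ^ 2) ^ 3) := by
    rw [hp]
    field_simp
    ring
  rw [hval, neg_lt_zero]
  positivity

/-- The sandwich inequality `R(2,r) < δ(r) < R(1,r)` relating the
Berger–Ghosh–Mukhopadhyay threshold `R(t,r) = ((2r+t)/(2r²))·log((2r+t)/t) − 1/r`
and the intrinsic-prior threshold `δ(r) = (r-1)/((r+1)^((r-1)/r) - 1) - 1`. -/
theorem R_delta_sandwich (r : ℝ) (hr : 1 < r) :
    let R : ℝ → ℝ → ℝ := fun t r => (2 * r + t) / (2 * r ^ 2) * Real.log ((2 * r + t) / t) - 1 / r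
    let δ : ℝ := (r - 1) / ((r + 1) ^ ((r - 1) / r) - 1) - 1
    R 2 r < δ ∧ δ < R 1 r := by
  intro R δ
  have hr0 : 0 < r := by linarith
  have hr1 : 0 < r - 1 := by linarith
  have hL : 0 < log (1 + r) := log_pos (by linarith)
  have hlow := exp_sub_div_lower hr hL
  have hup := exp_sub_div_upper hr hL
  have hP := meanLog_pos hr0
  have hP2 := meanLog_lt_half hr0
  have hR2 : R 2 r = meanLog r / r := by
    simp only [R]
    rw [show (2 * r + 2) / 2 = 1 + r by ring, meanLog]
    field_simp
    ring
  have hR1 : R 1 r = meanLog (2 * r) / r := by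
    simp only [R]
    rw [show (2 * r + 1) / 1 = 1 + 2 * r by ring, meanLog]
    field_simp
    ring
  have hpow : (r + 1) ^ ((r - 1) / r) = exp (log (1 + r) - log (1 + r) / r) := by
    rw [rpow_def_of_pos (by positivity), add_comm r 1]
    congr 1
    field_simp
  have hLP : log (1 + r) = r * (meanLog r + 1) / (1 + r) := by
    rw [meanLog]
    field_simp
    ring
  have hexp : exp (log (1 + r)) = 1 + r := exp_log (by positivity)
  set E := exp (log (1 + r) - log (1 + r) / r) with hE
  rw [hexp, hLP] at hlow hup
  have hδ : δ = (r - 1) / (E - 1) - 1 := by simp only [δ]; rw [hpow]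
  rw [hR2, hR1, hδ]
  have hcub := meanLog_cubic_neg hr0
  have hprod := sq_lt_sub_meanLog_mul_add_meanLog hr0
  have hQ := meanLog_pos (by positivity : 0 < 2 * r)
  set P := meanLog r
  set Q := meanLog (2 * r)
  obtain ⟨e, he⟩ : ∃ e, e = (E - 1) / (r - 1) := ⟨_, rfl⟩
  have hEe : E - 1 = e * (r - 1) := by rw [he]; field_simp
  have hre : r / (r - 1) * (E - 1) = r * e := by rw [he]; ring
  rw [hre] at hlow hup
  have hlow' : r - P < r * e := by
    refine lt_of_eq_of_lt ?_ hlow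
    field_simp
    ring
  have he0 : 0 < e := pos_of_mul_pos_right (by linarith : 0 < r * e) hr0.le
  have hinv : (r - 1) / (E - 1) = 1 / e := by rw [hEe]; field_simp
  have hup' : r * e < r - P + (r * (P + 1) ^ 2 / (1 + r) - 2 * P) / (2 * r) := by
    refine lt_of_lt_of_eq hup ?_
    field_simp
    ring
  rw [hinv]
  constructor
  · rw [lt_sub_iff_add_lt, lt_div_iff₀ he0]
    have h3 := mul_lt_mul_of_pos_right hup' (by positivity : 0 < r + P)
    have h4 : (r - P + (r * (P + 1) ^ 2 / (1 + r) - 2 * P) / (2 * r)) * (r + P) < r ^ 2 := by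
      rw [← sub_neg]
      have : (r - P + (r * (P + 1) ^ 2 / (1 + r) - 2 * P) / (2 * r)) * (r + P) - r ^ 2 =
        (r * P ^ 3 - r ^ 2 * P ^ 2 - 2 * r * P ^ 2 - 2 * P ^ 2 - r * P + r ^ 2)
          / (2 * r * (1 + r)) := by
        field_simp
        ring
      rw [this]
      exact div_neg_of_neg_of_pos hcub (by positivity)
    have h5 : (P / r + 1) * e * r ^ 2 < 1 * r ^ 2 := by
      have : (P / r + 1) * e * r ^ 2 = r * e * (r + P) := by field_simp; ring
      linarith
    exact lt_of_mul_lt_mul_right h5 (by positivity)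
  · rw [sub_lt_iff_lt_add, div_lt_iff₀ he0]
    have h3 := mul_lt_mul_of_pos_right hlow' (by positivity : 0 < r + Q)
    have h5 : 1 * r ^ 2 < (Q / r + 1) * e * r ^ 2 := by
      have : (Q / r + 1) * e * r ^ 2 = r * e * (r + Q) := by field_simp; ring
      linarith
    exact lt_of_mul_lt_mul_right h5 (by positivity)
end
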